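/- Let D ∈ CD_{n,k} be a chord diagram, let Z ∈ Mat_{n×(k+4)}(ℝ) be positive, and let C and C′ be domino matrices of D, both satisfying the sign rules. If the row spaces of CZ and C′Z in ℝ^{k+4} coincide, then the row spaces of C and C′ in ℝ^n coincide. (Equivalently: the amplituhedron map Z̃ is injective on each BCFW cell S_D.) -/

import Mathlib

open scoped Classical

noncomputable section

/-- A rectangular `n × r` matrix (with `r ≤ n`) is *positive* if all of its maximal
`r × r` minors (rows selected in increasing order) have positive determinant. -/
def IsPositiveMatrix {n r : ℕ} (Z : Matrix (Fin n) (Fin r) ℝ) : Prop :=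
  ∀ f : Fin r → Fin n, StrictMono f → 0 < (Z.submatrix f id).det

/-- A `k × n` matrix is *totally nonnegative* if all of its `k × k` minors
(columns selected in increasing order) have nonnegative determinant. -/
def IsTotallyNonnegRect {k n : ℕ} (C : Matrix (Fin k) (Fin n) ℝ) : Prop :=
  ∀ g : Fin k → Fin n, StrictMono g → 0 ≤ (C.submatrix id g).det

/-- The row of `Z` whose (1-based) marker is `p`, i.e. the row with index `p - 1`. -/
def markerRow {n r : ℕ} (Z : Matrix (Fin n) (Fin r) ℝ) (p : ℕ) : Fin r → ℝ :=
  if h : p - 1 < n then Z ⟨p - 1, h⟩ else 0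

/-- The twistor coordinate `⟨Y a₁ a₂ a₃ a₄⟩`: the determinant of the `(k+4) × (k+4)` matrix
whose rows are the `k` rows of `Y` followed by the rows of `Z` with (1-based) markers
`a 0, a 1, a 2, a 3`. -/
def twistor {n k : ℕ} (Z : Matrix (Fin n) (Fin (k + 4)) ℝ)
    (Y : Matrix (Fin k) (Fin (k + 4)) ℝ) (a : Fin 4 → ℕ) : ℝ :=
  ((Matrix.fromRows Y (Matrix.of fun t => markerRow Z (a t))).submatrix
    (⇑finSumFinEquiv.symm) id).det

/-- The row space of a matrix: the span of its rows. -/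
def rowSpace {k n : ℕ} (A : Matrix (Fin k) (Fin n) ℝ) : Submodule ℝ (Fin n → ℝ) :=
  Submodule.span ℝ (Set.range fun r => A r)

/-- The minor of `A` on the set of rows `S` (taken in increasing order), using all columns;
defined to be `0` if `S` does not have the right cardinality. -/
def rowMinor {N r : ℕ} (A : Matrix (Fin N) (Fin r) ℝ) (S : Finset (Fin N)) : ℝ :=
  if h : S.card = r then (A.submatrix (fun t => (S.orderIsoOfFin h t).1) id).det else 0

/-- The minor of `C` on the set of columns `J` (taken in increasing order), using all rows;
defined to be `0` if `J` does not have the right cardinality. -/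
def colMinor {k N : ℕ} (C : Matrix (Fin k) (Fin N) ℝ) (J : Finset (Fin N)) : ℝ :=
  if h : J.card = k then (C.submatrix id (fun t => (J.orderIsoOfFin h t).1)).det else 0

/-- A chord diagram with `n` markers (labelled `1, …, n`) and `k` chords
`c_l = (tail l, tail l + 1, head l, head l + 1)`. -/
structure ChordDiagram (n k : ℕ) where
  tail : Fin k → ℕ
  head : Fin k → ℕ
  one_le_tail : ∀ l, 1 ≤ tail l
  tail_add_two_le_head : ∀ l, tail l + 2 ≤ head l
  head_add_two_le : ∀ l, head l + 2 ≤ n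
  tail_strictMono : StrictMono tail
  noncrossing : ∀ l m : Fin k, l < m → ¬(tail m < head l ∧ head l < head m)

namespace ChordDiagram

variable {n k : ℕ} (D : ChordDiagram n k)

/-- `c_m` is a descendant of `c_l`. -/
def Descendant (l m : Fin k) : Prop := D.tail l < D.tail m ∧ D.head m ≤ D.head l

/-- The number of descendants of `c_l`. -/
def below (l : Fin k) : ℕ := (Finset.univ.filter fun m => D.Descendant l m).card

/-- `c_l` is a top chord: it has no ancestor. -/
def IsTop (l : Fin k) : Prop := ∀ m, ¬ D.Descendant m l

/-- `c_m` is the parent of `c_l`: the ancestor of `c_l` with the largest start. -/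
def IsParent (m l : Fin k) : Prop :=
  D.Descendant m l ∧ ∀ m', D.Descendant m' l → D.tail m' ≤ D.tail m

/-- The number of chords starting after the start of `c_l` (equals `k - l` for the
`l`-th chord in the 1-based start-increasing ordering). -/
def behind (l : Fin k) : ℕ := (Finset.univ.filter fun m => D.tail l < D.tail m).card

/-- The number of descendants of `c_m` (the parent of `c_l`) that come before `c_l`
(equals `l - m - 1` in the 1-based start-increasing ordering). -/
def beyond (l m : Fin k) : ℕ :=
  (Finset.univ.filter fun h => D.Descendant m h ∧ D.tail h < D.tail l).card

/-- The domino matrix of `D` with variables `α, β, γ, δ, ε` : the column with (0-based)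
index `a` corresponds to the (1-based) marker `a + 1`. -/
def dominoMatrix (α β γ δ ε : Fin k → ℝ) : Matrix (Fin k) (Fin n) ℝ :=
  Matrix.of fun l a =>
    (if (a : ℕ) + 1 = D.tail l then α l else 0) +
    (if (a : ℕ) + 1 = D.tail l + 1 then β l else 0) +
    (if (a : ℕ) + 1 = D.head l then γ l else 0) +
    (if (a : ℕ) + 1 = D.head l + 1 then δ l else 0) +
    (if D.IsTop l ∧ (a : ℕ) + 1 = n then ε l else 0) +
    (∑ m : Fin k, if D.IsParent m l then
        (if (a : ℕ) + 1 = D.tail m then ε l * α m else 0) +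
        (if (a : ℕ) + 1 = D.tail m + 1 then ε l * β m else 0)
      else 0)

/-- The sign rules for the domino variables of `D`. -/
def SignRules (α β γ δ ε : Fin k → ℝ) : Prop :=
  (∀ l, 0 < α l) ∧ (∀ l, 0 < β l) ∧
  (∀ l, 0 < (-1 : ℝ) ^ D.below l * γ l) ∧
  (∀ l, 0 < (-1 : ℝ) ^ D.below l * δ l) ∧
  (∀ l, D.IsTop l → 0 < (-1 : ℝ) ^ D.behind l * ε l) ∧
  (∀ l m, D.IsParent m l → 0 < (-1 : ℝ) ^ D.beyond l m * ε l) ∧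
  (∀ l m, D.IsParent m l → D.head l = D.head m → δ l / γ l < δ m / γ m) ∧
  (∀ l m, D.head m = D.tail l → δ m / γ m < β l / α l)

end ChordDiagram

/-- `w` changes sign at most `m` times, starting (weakly) from a nonnegative sign. -/
def SignBounded (m : ℕ) (w : ℕ → ℝ) : Prop :=
  ∃ g : ℕ → ℕ, Monotone g ∧ (∀ x, g x ≤ m) ∧ ∀ x, 0 ≤ (-1 : ℝ) ^ g x * w x

/-- `w` has at most `m` sign changes. -/
def VarBounded (m : ℕ) (w : ℕ → ℝ) : Prop :=
  SignBounded m w ∨ SignBounded m (-w)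

theorem SignBounded.mono {m m' : ℕ} {w : ℕ → ℝ} (h : SignBounded m w) (hm : m ≤ m') :
    SignBounded m' w := by
  obtain ⟨g, hg, hb, hs⟩ := h
  exact ⟨g, hg, fun x => (hb x).trans hm, hs⟩

theorem SignBounded.neg_succ {m : ℕ} {w : ℕ → ℝ} (h : SignBounded m w) :
    SignBounded (m + 1) (-w) := by
  obtain ⟨g, hg, hb, hs⟩ := h
  refine ⟨fun x => g x + 1, fun x y hxy => Nat.succ_le_succ (hg hxy),
    fun x => Nat.succ_le_succ (hb x), fun x => ?_⟩
  have := hs x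
  simp only [Pi.neg_apply, pow_succ]
  linarith

theorem VarBounded.neg {m : ℕ} {w : ℕ → ℝ} (h : VarBounded m w) : VarBounded m (-w) := by
  rcases h with h | h
  · right; rwa [neg_neg]
  · left; exact h

theorem VarBounded.signBounded_succ {m : ℕ} {w : ℕ → ℝ} (h : VarBounded m w) :
    SignBounded (m + 1) w := by
  rcases h with h | h
  · exact h.mono (Nat.le_succ m)
  · simpa using h.neg_succ

theorem signBounded_zero (m : ℕ) : SignBounded m 0 :=
  ⟨fun _ => 0, monotone_const, fun _ => Nat.zero_le _, fun x => by simp⟩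

/-- A sequence with at most `m` sign changes whose first entry is negative starts negative. -/
theorem VarBounded.signBounded_neg {m : ℕ} {w : ℕ → ℝ} (h : VarBounded m w) (h0 : w 0 < 0) :
    SignBounded m (-w) := by
  rcases h with ⟨g, hg, hb, hs⟩ | h
  · have h1 : 1 ≤ g 0 := by
      by_contra hc
      have h2 := hs 0
      rw [show g 0 = 0 by omega, pow_zero, one_mul] at h2
      linarith
    have h1' : ∀ x, 1 ≤ g x := fun x => h1.trans (hg (Nat.zero_le x))
    refine ⟨fun x => g x - 1, fun x y hxy => Nat.sub_le_sub_right (hg hxy) 1,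
      fun x => (Nat.sub_le _ _).trans (hb x), fun x => ?_⟩
    have h2 := hs x
    obtain ⟨t, ht⟩ := Nat.exists_eq_add_of_le' (h1' x)
    rw [ht, pow_succ] at h2
    simp only [ht, Nat.add_sub_cancel, Pi.neg_apply]
    linarith
  · exact h

theorem exists_sign_index_add {p q : ℕ} {a b : ℝ} (hpq : p ≤ q) (ha : 0 ≤ (-1 : ℝ) ^ p * a)
    (hb : 0 ≤ (-1 : ℝ) ^ q * b) : ∃ t, p ≤ t ∧ t ≤ q ∧ 0 ≤ (-1 : ℝ) ^ t * (a + b) := by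
  by_cases h : 0 ≤ (-1 : ℝ) ^ p * (a + b)
  · exact ⟨p, le_rfl, hpq, h⟩
  · refine ⟨q, hpq, le_rfl, ?_⟩
    rcases neg_one_pow_eq_or ℝ p with h1 | h1 <;> rcases neg_one_pow_eq_or ℝ q with h2 | h2 <;>
      rw [h1] at h ha <;> rw [h2] at hb ⊢ <;> linarith

/-- The sequence obtained by joining `U` (left of `i`) and `W` (right of `i`) with a chord
with tail at `i, i + 1` and head at `j, j + 1`. -/
def joinSeq (i j : ℕ) (f g t e d : ℝ) (U W : ℕ → ℝ) (x : ℕ) : ℝ :=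
  if x = 0 then U 0 + e
  else if x < i then U x
  else if x = i then U i + f * (U (i + 1) + t)
  else if x = i + 1 then U (i + 1) + t + W (i + 1)
  else if x < j then W x
  else if x = j then W j + g * (W (j + 1) + d)
  else if x = j + 1 then W (j + 1) + d
  else 0

theorem signBounded_joinSeq {i j M μ : ℕ} {f g t e d : ℝ} {U W : ℕ → ℝ} {gU gW : ℕ → ℕ}
    (hi : 1 ≤ i) (hij : i + 2 ≤ j) (hf : 0 ≤ f) (hg : 0 ≤ g)
    (mU : Monotone gU) (mW : Monotone gW) (hUμ : ∀ x, gU x ≤ μ) (hμW : ∀ x, μ ≤ gW x)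
    (hWM : ∀ x, gW x ≤ M)
    (sU : ∀ x, 0 ≤ (-1 : ℝ) ^ gU x * U x) (sW : ∀ x, x ≠ 0 → 0 ≤ (-1 : ℝ) ^ gW x * W x)
    (st : 0 ≤ (-1 : ℝ) ^ μ * t) (se : 0 ≤ e) (sd : 0 ≤ (-1 : ℝ) ^ M * d) :
    SignBounded M (joinSeq i j f g t e d U W) := by
  have scale : ∀ {c z : ℝ} {p : ℕ}, 0 ≤ c → 0 ≤ (-1 : ℝ) ^ p * z → 0 ≤ (-1 : ℝ) ^ p * (c * z) :=
    fun {c z p} hc hz => by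
      have := mul_nonneg hc hz
      linarith
  obtain ⟨t0, -, h0', h0⟩ := exists_sign_index_add (Nat.zero_le (gU 0)) (a := e) (by simpa using se)
    (sU 0)
  obtain ⟨tz, hz1, hz2, hz⟩ := exists_sign_index_add (hUμ (i + 1)) (sU (i + 1)) st
  obtain ⟨ti, hi1, hi2, hti⟩ := exists_sign_index_add ((mU (Nat.le_succ i)).trans hz1) (sU i)
    (scale hf hz)
  obtain ⟨tn, hn1, hn2, htn⟩ := exists_sign_index_add (hz2.trans (hμW (i + 1))) hz
    (sW (i + 1) (by omega))
  obtain ⟨tk, hk1, hk2, htk⟩ := exists_sign_index_add (hWM (j + 1)) (sW (j + 1) (by omega)) sd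
  obtain ⟨tj, hj1, hj2, htj⟩ := exists_sign_index_add ((mW (Nat.le_succ j)).trans hk1)
    (sW j (by omega)) (scale hg htk)
  refine ⟨fun x => if x = 0 then t0 else if x < i then gU x else if x = i then ti
    else if x = i + 1 then tn else if x < j then gW x else if x = j then tj else tk,
    monotone_nat_of_le_succ fun x => ?_, fun x => ?_, fun x => ?_⟩
  · have a1 : gU x ≤ gU (x + 1) := mU (Nat.le_succ x)
    have a2 : gW x ≤ gW (x + 1) := mW (Nat.le_succ x)
    have a3 := hUμ x
    have a4 := hμW x
    have a6 := mU (Nat.zero_le (x + 1))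
    have a7 : x ≤ i → gU x ≤ gU i := fun h => mU h
    have a8 : i + 1 ≤ x + 1 → gW (i + 1) ≤ gW (x + 1) := fun h => mW h
    have a9 : x ≤ j → gW x ≤ gW j := fun h => mW h
    have a10 : i + 1 ≤ j → gW (i + 1) ≤ gW j := fun h => mW h
    have a11 := mU (Nat.zero_le i)
    clear sU sW st se sd h0 hz hti htn htk htj mU mW hUμ hμW hWM scale
    by_cases c0 : x = 0
    · subst c0
      by_cases c1 : 0 + 1 < i
      · rw [if_pos rfl, if_neg (by omega), if_pos c1]; omega
      · obtain rfl : i = 1 := by omega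
        simp; omega
    by_cases c1 : x + 1 < i
    · rw [if_neg c0, if_pos (by omega), if_neg (by omega), if_pos c1]; exact a1
    by_cases c2 : x + 1 = i
    · rw [if_neg c0, if_pos (by omega), if_neg (by omega), if_neg c1, if_pos c2]; omega
    by_cases c3 : x = i
    · rw [if_neg c0, if_neg (by omega), if_pos c3, if_neg (by omega), if_neg (by omega),
        if_neg (by omega), if_pos (by omega)]
      omega
    rw [if_neg c0, if_neg (by omega), if_neg c3, if_neg (by omega : ¬ x + 1 = 0), if_neg c1,
      if_neg c2, if_neg (by omega : ¬ x + 1 = i + 1)]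
    split_ifs <;> omega
  · have a1 := hWM x
    have a2 := (hUμ x).trans (hμW x)
    have a3 := hWM (i + 1)
    have a4 := (hUμ 0).trans (hμW 0)
    have a5 := hWM 0
    dsimp only
    split_ifs <;> omega
  · unfold joinSeq
    dsimp only
    split_ifs with c1 c2 c3 c4 c5 c6 c7
    · rw [add_comm]; exact h0
    · exact sU x
    · exact hti
    · exact htn
    · exact sW x c1
    · exact htj
    · exact htk
    · simp

theorem varBounded_joinSeq_of_nonneg {i j l r : ℕ} {f g β ε δ b : ℝ} {U W : ℕ → ℝ}
    (hi : 1 ≤ i) (hij : i + 2 ≤ j) (hf : 0 ≤ f) (hg : 0 ≤ g) (hβ : 0 ≤ β)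
    (hε : 0 ≤ (-1 : ℝ) ^ l * ε) (hδ : 0 ≤ (-1 : ℝ) ^ r * δ)
    (hU : SignBounded l U) (hU' : SignBounded l (-U))
    (hW : SignBounded r W) (hW' : SignBounded r (-W))
    (hW0 : W 0 < 0 → ∃ r', r = r' + 1 ∧ SignBounded r' (-W)) (hb : 0 ≤ b) :
    VarBounded (l + r) (joinSeq i j f g ((b + W 0) * β) (b * ε) (b * δ) U W) := by
  have key : SignBounded (l + r) (joinSeq i j f g ((-1) ^ l * ((b + W 0) * β))
      ((-1) ^ l * (b * ε)) ((-1) ^ l * (b * δ)) ((-1) ^ l * U) ((-1) ^ l * W)) := by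
    have sq : (-1 : ℝ) ^ l * (-1) ^ l = 1 := by
      rw [← pow_add, ← two_mul, pow_mul]; norm_num
    have hUl : SignBounded l ((-1) ^ l * U) := by
      rcases neg_one_pow_eq_or (ℕ → ℝ) l with h | h <;> rw [h] <;> simpa
    have he : 0 ≤ (-1 : ℝ) ^ l * (b * ε) := by
      have := mul_nonneg hb hε
      linarith
    have hd : 0 ≤ (-1 : ℝ) ^ (l + r) * ((-1) ^ l * (b * δ)) := by
      have := mul_nonneg hb hδ
      calc 0 ≤ b * ((-1 : ℝ) ^ r * δ) := this
        _ = ((-1 : ℝ) ^ l * (-1) ^ l) * (b * ((-1 : ℝ) ^ r * δ)) := by rw [sq, one_mul]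
        _ = _ := by rw [pow_add]; ring
    have key2 : ∀ (p q : ℕ) (z : ℝ), (-1 : ℝ) ^ (l + p) * ((-1) ^ l * z) = (-1) ^ p * z := by
      intro p q z
      calc _ = ((-1 : ℝ) ^ l * (-1) ^ l) * ((-1 : ℝ) ^ p * z) := by rw [pow_add]; ring
        _ = _ := by rw [sq, one_mul]
    obtain ⟨gU, mU, bU, sU⟩ := hUl
    have fin : ∀ (ν r' : ℕ) (gW : ℕ → ℕ), Monotone gW → (∀ x, gW x ≤ r') → ν + r' ≤ r →
        (∀ x, x ≠ 0 → 0 ≤ (-1 : ℝ) ^ (ν + gW x) * W x) → 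
        (0 ≤ (-1 : ℝ) ^ ν * (b + W 0)) →
        SignBounded (l + r) (joinSeq i j f g ((-1) ^ l * ((b + W 0) * β))
      ((-1) ^ l * (b * ε)) ((-1) ^ l * (b * δ)) ((-1) ^ l * U) ((-1) ^ l * W)) := by
      intro ν r' gW mW bW hr sW st
      refine signBounded_joinSeq (gU := gU) (gW := fun x => l + (ν + gW x)) (μ := l + ν)
        hi hij hf hg mU (fun x y h => ?_) (fun x => ?_)
        (fun x => ?_) (fun x => ?_) sU (fun x hx => ?_) ?_ he hd
      · have := mW h
        dsimp only; omega
      · have := bU x; omega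
      · omega
      · have := bW x
        omega
      · have := sW x hx
        rcases neg_one_pow_eq_or ℝ l with h | h <;> rw [pow_add, h] <;> simp [h] <;> linarith
      · rw [key2 ν 0]
        have := mul_nonneg st hβ
        linarith
    rcases hb.eq_or_lt with hb0 | hb0
    · obtain ⟨gW, mW, bW, sW⟩ := hW
      by_cases hz : 0 ≤ W 0
      · exact fin 0 r gW mW bW (by omega) (fun x _ => by simpa using sW x) (by
          rw [← hb0]; simpa using hz)
      · obtain ⟨r', rfl, gV, mV, bV, sV⟩ := hW0 (not_le.1 hz)
        refine fin 1 r' gV mV bV (by omega) (fun x _ => ?_) ?_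
        · have := sV x
          simp only [Pi.neg_apply] at this
          rw [pow_add]; linarith
        · rw [← hb0, pow_one]; linarith [not_le.1 hz]
    · by_cases hz : 0 ≤ b + W 0
      · obtain ⟨gW, mW, bW, sW⟩ := hW
        exact fin 0 r gW mW bW (by omega) (fun x _ => by simpa using sW x) (by simpa using hz)
      · obtain ⟨r', rfl, gV, mV, bV, sV⟩ := hW0 (by linarith [not_le.1 hz])
        refine fin 1 r' gV mV bV (by omega) (fun x _ => ?_) ?_
        · have := sV x
          simp only [Pi.neg_apply] at this
          rw [pow_add]; linarith
        · rw [pow_one]; linarith [not_le.1 hz]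
  rcases neg_one_pow_eq_or ℝ l with h | h <;> rcases neg_one_pow_eq_or (ℕ → ℝ) l with h' | h' <;>
    rw [h, h'] at key
  · left; simpa using key
  · exfalso; have := congrFun h' 0; simp [h] at this; norm_num at this
  · exfalso; have := congrFun h' 0; simp [h] at this; norm_num at this
  · right
    convert key using 1
    ext x
    simp only [joinSeq, Pi.neg_apply, neg_mul, one_mul]
    split_ifs <;> ring

theorem varBounded_joinSeq {i j l r : ℕ} {f g β ε δ b : ℝ} {U W : ℕ → ℝ}
    (hi : 1 ≤ i) (hij : i + 2 ≤ j) (hf : 0 ≤ f) (hg : 0 ≤ g) (hβ : 0 ≤ β)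
    (hε : 0 ≤ (-1 : ℝ) ^ l * ε) (hδ : 0 ≤ (-1 : ℝ) ^ r * δ)
    (hU : l = 0 ∧ U = 0 ∨ ∃ l', l = l' + 1 ∧ VarBounded l' U)
    (hW : r = 0 ∧ W = 0 ∨ ∃ r', r = r' + 1 ∧ VarBounded r' W) :
    VarBounded (l + r) (joinSeq i j f g ((b + W 0) * β) (b * ε) (b * δ) U W) := by
  have aux : ∀ {m : ℕ} {V : ℕ → ℝ}, (m = 0 ∧ V = 0 ∨ ∃ m', m = m' + 1 ∧ VarBounded m' V) →
      SignBounded m V ∧ SignBounded m (-V) := by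
    rintro m V (⟨-, rfl⟩ | ⟨m', rfl, h⟩)
    · simpa using signBounded_zero m
    · exact ⟨h.signBounded_succ, h.neg.signBounded_succ⟩
  have hU2 := aux hU
  have hW2 := aux hW
  rcases le_total 0 b with hb | hb
  · refine varBounded_joinSeq_of_nonneg hi hij hf hg hβ hε hδ hU2.1 hU2.2 hW2.1 hW2.2
      (fun h0 => ?_) hb
    rcases hW with ⟨-, rfl⟩ | ⟨r', hr, h⟩
    · simp at h0
    · exact ⟨r', hr, h.signBounded_neg h0⟩
  · have := (varBounded_joinSeq_of_nonneg (U := -U) (W := -W) (b := -b) hi hij hf hg hβ hε hδ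
      hU2.2 (by simpa using hU2.1) hW2.2 (by simpa using hW2.1) (fun h0 => by
        rcases hW with ⟨-, rfl⟩ | ⟨r', hr, h⟩
        · simp at h0
        · exact ⟨r', hr, h.neg.signBounded_neg h0⟩) (by linarith)).neg
    convert this using 1
    ext x
    simp only [joinSeq, Pi.neg_apply]
    split_ifs <;> ring

/-- A monotone labelling of `{0, …, n - 1}` with at most `r + 1` labels can be refined to one
using exactly the labels `0, …, r`. -/
theorem exists_monotone_surjective_refinement {n r : ℕ} (hr : r + 1 ≤ n) {g : ℕ → ℕ}
    (hg : Monotone g) (hb : ∀ x, g x ≤ r) :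
    ∃ h : Fin n → Fin (r + 1), Monotone h ∧ Function.Surjective h ∧
      ∀ x y, h x = h y → g x = g y := by
  obtain ⟨c, hc1, hc2, hc3⟩ := Finset.exists_subsuperset_card_eq
    (s := (Finset.Ico 1 n).filter fun c => g (c - 1) < g c) (t := Finset.Ico 1 n) (n := r)
    (Finset.filter_subset _ _) (by
      calc _ ≤ (Finset.Ico 1 (r + 1)).card := by
            refine Finset.card_le_card_of_injOn g (fun x hx => ?_) (fun x hx y hy hxy => ?_)
            · simp only [Finset.coe_filter, Set.mem_ofPred_eq] at hx
              have := hb x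
              simp only [Finset.coe_Ico, Set.mem_Ico]
              omega
            · simp only [Finset.coe_filter, Set.mem_ofPred_eq] at hx hy
              rcases lt_trichotomy x y with h | h | h
              · have := hg (show x ≤ y - 1 by omega)
                omega
              · exact h
              · have := hg (show y ≤ x - 1 by omega)
                omega
        _ = r := by simp) (by simp; omega)
  set H : ℕ → ℕ := fun x => (c.filter (· ≤ x)).card with hH
  have Hb : ∀ x, H x < r + 1 := fun x =>
    Nat.lt_succ_of_le ((Finset.card_le_card (Finset.filter_subset _ _)).trans hc3.le)
  have Hm : Monotone H := fun x y hxy => Finset.card_le_card fun z hz => by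
    rw [Finset.mem_filter] at hz ⊢
    exact ⟨hz.1, hz.2.trans hxy⟩
  have H0 : H 0 = 0 := by
    rw [hH]
    simp only [Finset.card_eq_zero, Finset.filter_eq_empty_iff]
    intro z hz
    have := Finset.mem_Ico.1 (hc2 hz)
    omega
  have Hn : H (n - 1) = r := by
    rw [hH, ← hc3]
    dsimp only
    rw [Finset.filter_true_of_mem]
    intro z hz
    have := Finset.mem_Ico.1 (hc2 hz)
    omega
  have Hs : ∀ x, H (x + 1) ≤ H x + 1 := fun x => by
    calc H (x + 1) ≤ (insert (x + 1) (c.filter (· ≤ x))).card := Finset.card_le_card fun z hz => by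
          rw [Finset.mem_filter] at hz
          rw [Finset.mem_insert, Finset.mem_filter]
          by_cases h : z = x + 1
          · exact Or.inl h
          · exact Or.inr ⟨hz.1, by omega⟩
      _ ≤ _ := Finset.card_insert_le _ _
  have Hg : ∀ x d, x + d < n → H x = H (x + d) → g x = g (x + d) := by
    intro x d
    induction d with
    | zero => simp
    | succ d ih =>
      intro hd he
      have e1 := Hm (show x ≤ x + d by omega)
      have e2 := Hm (show x + d ≤ x + (d + 1) by omega)
      rw [ih (by omega) (by omega)]
      by_contra hne
      have h3 := hg (show x + d ≤ x + (d + 1) by omega)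
      have h4 : x + (d + 1) ∈ c := hc1 (by
        rw [Finset.mem_filter, Finset.mem_Ico]
        refine ⟨by omega, ?_⟩
        rw [show x + (d + 1) - 1 = x + d by omega]
        omega)
      have h5 : H (x + d) < H (x + (d + 1)) := by
        refine Finset.card_lt_card ((Finset.ssubset_iff_of_subset fun z hz => ?_).2
          ⟨x + (d + 1), ?_, ?_⟩)
        · rw [Finset.mem_filter] at hz ⊢
          exact ⟨hz.1, by omega⟩
        · rw [Finset.mem_filter]; exact ⟨h4, le_rfl⟩
        · rw [Finset.mem_filter]; omega
      omega
  refine ⟨fun x => ⟨H x, Hb x⟩, fun x y hxy => Hm hxy, fun b => ?_, fun x y hxy => ?_⟩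
  · have hex : ∃ x, (b : ℕ) ≤ H x := ⟨n - 1, by rw [Hn]; omega⟩
    have h1 := Nat.find_spec hex
    have h2 : Nat.find hex ≤ n - 1 := Nat.find_min' hex (by rw [Hn]; omega)
    refine ⟨⟨Nat.find hex, by omega⟩, Fin.ext ?_⟩
    refine le_antisymm ?_ h1
    change H (Nat.find hex) ≤ b
    rcases h : Nat.find hex with _ | t
    · simp [H0]
    · have h3 := Nat.find_min hex (m := t) (by omega)
      have h4 := Hs t
      omega
  · have hxy' : H x = H y := congrArg Fin.val hxy
    rcases le_total (x : ℕ) y with h | h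
    · obtain ⟨d, hd⟩ := Nat.exists_eq_add_of_le h
      rw [hd]
      exact Hg _ _ (by omega) (by rw [hxy', hd])
    · obtain ⟨d, hd⟩ := Nat.exists_eq_add_of_le h
      rw [hd]
      exact (Hg _ _ (by omega) (by rw [← hxy', hd])).symm

/-- Rows obtained by positively combining consecutive nonempty blocks of rows of a positive
matrix have positive determinant. -/
theorem IsPositiveMatrix.det_block_pos {n r : ℕ} {Z : Matrix (Fin n) (Fin r) ℝ}
    (hZ : IsPositiveMatrix Z) {h : Fin n → Fin r} (hm : Monotone h) {ω : Fin n → ℝ}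
    (hω : ∀ x, 0 ≤ ω x) (hpos : ∀ b, ∃ x, h x = b ∧ 0 < ω x) :
    0 < (Matrix.of fun b => ∑ x ∈ Finset.univ.filter (fun x => h x = b), ω x • Z x).det := by
  have hexp := (Matrix.detRowAlternating (n := Fin r) (R := ℝ)).toMultilinearMap.map_sum_finset
    (fun _ x => ω x • Z x) (fun b => Finset.univ.filter fun x => h x = b)
  have hterm : ∀ f : Fin r → Fin n,
      (Matrix.detRowAlternating (n := Fin r) (R := ℝ)).toMultilinearMap
        (fun b => ω (f b) • Z (f b)) = (∏ b, ω (f b)) * (Z.submatrix f id).det := by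
    intro f
    rw [MultilinearMap.map_smul_univ, smul_eq_mul]
    rfl
  have hmono : ∀ f ∈ Fintype.piFinset fun b => Finset.univ.filter fun x => h x = b,
      0 < (Z.submatrix f id).det := by
    intro f hf
    refine hZ f fun b b' hb => ?_
    rw [Fintype.mem_piFinset] at hf
    have h1 := (Finset.mem_filter.1 (hf b)).2
    have h2 := (Finset.mem_filter.1 (hf b')).2
    by_contra hc
    have := hm (not_lt.1 hc)
    rw [h1, h2] at this
    exact absurd hb (not_lt.2 this)
  simp only [hterm] at hexp
  refine lt_of_lt_of_eq ?_ hexp.symm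
  choose f hf using hpos
  refine Finset.sum_pos' (fun g hg => mul_nonneg (Finset.prod_nonneg fun b _ => hω _)
    (hmono g hg).le) ⟨f, ?_, ?_⟩
  · rw [Fintype.mem_piFinset]
    intro b
    exact Finset.mem_filter.2 ⟨Finset.mem_univ _, (hf b).1⟩
  · refine mul_pos (Finset.prod_pos fun b _ => (hf b).2) (hmono f ?_)
    rw [Fintype.mem_piFinset]
    intro b
    exact Finset.mem_filter.2 ⟨Finset.mem_univ _, (hf b).1⟩

/-- A nonzero vector in the left kernel of a positive `n × (r + 1)` matrix has more than `r`
sign changes. -/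
theorem IsPositiveMatrix.eq_zero_of_vecMul_eq_zero {n r : ℕ} (hr : r + 1 ≤ n)
    {Z : Matrix (Fin n) (Fin (r + 1)) ℝ} (hZ : IsPositiveMatrix Z) {w : Fin n → ℝ}
    (hw : Matrix.vecMul w Z = 0) {g : ℕ → ℕ} (hg : Monotone g) (hb : ∀ x, g x ≤ r)
    (hs : ∀ x : Fin n, 0 ≤ (-1 : ℝ) ^ g x * w x) : w = 0 := by
  obtain ⟨h, hm, hsurj, hgh⟩ := exists_monotone_surjective_refinement hr hg hb
  set ω : Fin n → ℝ := fun x => if ∃ y, h y = h x ∧ w y ≠ 0 then |w x| else 1 with hωdef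
  choose p hp using hsurj
  set s : Fin (r + 1) → ℝ := fun b => if ∃ y, h y = b ∧ w y ≠ 0 then (-1 : ℝ) ^ g (p b) else 0
    with hsdef
  have hsw : ∀ x, s (h x) * ω x = w x := by
    intro x
    simp only [hsdef, hωdef]
    split_ifs with hx
    · rw [← hgh x (p (h x)) (hp _).symm]
      have := hs x
      rcases neg_one_pow_eq_or ℝ (g x) with e | e <;> rw [e] at this ⊢
      · rw [abs_of_nonneg (by linarith)]; ring
      · rw [abs_of_nonpos (by linarith)]; ring
    · push Not at hx
      rw [hx x rfl, zero_mul]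
  have hdet := hZ.det_block_pos hm (ω := ω) (fun x => by
    simp only [hωdef]; split_ifs <;> positivity) (fun b => by
      by_cases hy : ∃ y, h y = b ∧ w y ≠ 0
      · obtain ⟨y, hy1, hy2⟩ := hy
        refine ⟨y, hy1, ?_⟩
        simp only [hωdef]
        rw [if_pos ⟨y, rfl, hy2⟩]
        positivity
      · refine ⟨p b, hp b, ?_⟩
        simp only [hωdef]
        rw [hp b, if_neg hy]
        norm_num)
  have hs0 : Matrix.vecMul s
      (Matrix.of fun b => ∑ x ∈ Finset.univ.filter (fun x => h x = b), ω x • Z x) = 0 := by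
    rw [← hw]
    ext c
    simp only [Matrix.vecMul, dotProduct, Matrix.of_apply, Finset.sum_apply, Pi.smul_apply,
      smul_eq_mul, Finset.mul_sum]
    rw [← Finset.sum_fiberwise (s := Finset.univ) (g := h)]
    refine Finset.sum_congr rfl fun b _ => Finset.sum_congr rfl fun x hx => ?_
    rw [← (Finset.mem_filter.1 hx).2, ← mul_assoc, hsw]
  have hs1 : s = 0 := Matrix.eq_zero_of_vecMul_eq_zero hdet.ne' hs0
  ext x
  rw [← hsw x, hs1]
  simp

namespace ChordDiagram

variable {n k : ℕ} {D : ChordDiagram n k}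

theorem descendant_iff {l m : Fin k} : D.Descendant l m ↔ l < m ∧ D.head m ≤ D.head l := by
  rw [Descendant, D.tail_strictMono.lt_iff_lt]

theorem head_le_of_tail_lt {l m : Fin k} (hlm : l < m) (h : D.tail m < D.head l) :
    D.head m ≤ D.head l := by
  by_contra hc
  exact D.noncrossing l m hlm ⟨h, not_le.1 hc⟩

theorem Descendant.trans {l m h : Fin k} (h₁ : D.Descendant l m) (h₂ : D.Descendant m h) :
    D.Descendant l h :=
  ⟨h₁.1.trans h₂.1, h₂.2.trans h₁.2⟩

theorem Descendant.lt {l m : Fin k} (h : D.Descendant l m) : l < m :=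
  (descendant_iff.1 h).1

theorem Descendant.of_lt_of_lt {l m h : Fin k} (hd : D.Descendant l h) (hlm : l < m)
    (hmh : m < h) : D.Descendant l m := by
  refine descendant_iff.2 ⟨hlm, head_le_of_tail_lt hlm ?_⟩
  have := D.tail_strictMono hmh
  have := D.tail_add_two_le_head h
  have := hd.2
  omega

variable (D)

/-- The chords of `S` without an ancestor in `S`. -/
def topsIn (S : Finset (Fin k)) : Finset (Fin k) :=
  S.filter fun l => ∀ m ∈ S, ¬ D.Descendant m l

/-- The coefficient of `(α_d, β_d)` at the tail of `c_d` in the linear combination of the rows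
of a domino matrix with coefficients `a`. -/
def tailCoeff (ε a : Fin k → ℝ) (d : Fin k) : ℝ :=
  a d + ∑ l, if D.IsParent d l then ε l * a l else 0

/-- The part of a linear combination of domino rows supported on the markers of chords in `S`,
with `f = α / β` and `g = γ / δ`. -/
def comb (S : Finset (Fin k)) (f β g δ ε a : Fin k → ℝ) (x : ℕ) : ℝ :=
  ∑ d ∈ S, (D.tailCoeff ε a d * β d *
      (f d * (if x = D.tail d then 1 else 0) + if x = D.tail d + 1 then 1 else 0) +
    a d * δ d * (g d * (if x = D.head d then 1 else 0) + if x = D.head d + 1 then 1 else 0))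

/-- The sequence `comb` preceded at `0` by `σ` times the contribution of the top chords of `S`
to the last column. -/
def combSeq (S : Finset (Fin k)) (f β g δ ε a : Fin k → ℝ) (σ : ℝ) (x : ℕ) : ℝ :=
  if x = 0 then σ * ∑ l ∈ D.topsIn S, ε l * a l else D.comb S f β g δ ε a x

variable {D} {f β δ ε a : Fin k → ℝ}

theorem comb_shift {S : Finset (Fin k)} {g : Fin k → ℝ} {i : ℕ} (hS : ∀ l ∈ S, D.head l ≤ i)
    (φ : ℝ) (x : ℕ) :
    D.comb S f β g δ ε a x =
      D.comb S f β (fun l => g l - if D.head l = i then φ else 0) δ ε a x +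
        if x = i then
          φ * D.comb S f β (fun l => g l - if D.head l = i then φ else 0) δ ε a (i + 1)
        else 0 := by
  have hT : ∀ l ∈ S, ¬ i + 1 = D.tail l ∧ ¬ i + 1 = D.tail l + 1 ∧ ¬ i + 1 = D.head l := by
    intro l hl
    have := D.tail_add_two_le_head l
    have := hS l hl
    omega
  by_cases hx : x = i
  · subst hx
    rw [if_pos rfl]
    unfold comb
    rw [Finset.mul_sum, ← Finset.sum_add_distrib]
    refine Finset.sum_congr rfl fun l hl => ?_
    obtain ⟨h1, h2, h3⟩ := hT l hl
    rw [if_neg h1, if_neg h2, if_neg h3]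
    by_cases hj : D.head l = x
    · have h4 : ¬ x = D.head l + 1 := by omega
      rw [if_neg h4]
      simp only [hj, if_true]
      ring
    · have h4 : ¬ x + 1 = D.head l + 1 := by omega
      rw [if_neg h4]
      simp only [hj, if_false]
      ring
  · rw [if_neg hx, add_zero]
    refine Finset.sum_congr rfl fun l hl => ?_
    by_cases hj : D.head l = i
    · have h4 : ¬ x = D.head l := by omega
      simp only [if_neg h4]
      ring
    · simp only [hj, if_false]
      ring

theorem comb_eq_zero {S : Finset (Fin k)} {g : Fin k → ℝ} {x : ℕ}
    (hS : ∀ l ∈ S, x < D.tail l ∨ D.head l + 1 < x) : D.comb S f β g δ ε a x = 0 := by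
  refine Finset.sum_eq_zero fun l hl => ?_
  have := D.tail_add_two_le_head l
  have := hS l hl
  rw [if_neg (by omega), if_neg (by omega), if_neg (by omega), if_neg (by omega)]
  ring

theorem varBounded_combSeq (hf : ∀ l, 0 ≤ f l) (hβ : ∀ l, 0 ≤ β l)
    (hδ : ∀ l, 0 ≤ (-1 : ℝ) ^ D.below l * δ l)
    (hε : ∀ l m, D.IsParent m l → 0 ≤ (-1 : ℝ) ^ D.beyond l m * ε l) (N : ℕ) :
    ∀ S : Finset (Fin k), S.card = N + 1 →
    (∀ l ∈ S, ∀ m, D.Descendant l m → m ∈ S) → ∀ g : Fin k → ℝ, (∀ l ∈ S, 0 ≤ g l) →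
    (∀ l ∈ S, ∀ m ∈ S, D.Descendant m l → D.head l = D.head m → g m ≤ g l) →
    (∀ l ∈ S, ∀ m ∈ S, D.head m = D.tail l → f l ≤ g m) →
    ∀ σ : ℝ, (∀ l ∈ D.topsIn S, 0 ≤ (-1 : ℝ) ^ (S.filter (· < l)).card * (σ * ε l)) →
    VarBounded N (D.combSeq S f β g δ ε a σ) := by
  induction N using Nat.strong_induction_on with
  | _ N ih =>
  intro S hcard hcl g hg hgg hfg σ hσ
  obtain ⟨c, hcS, hcmax⟩ : ∃ c ∈ S, ∀ l ∈ S, D.head l ≤ D.head c ∧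
      (D.head l = D.head c → c ≤ l) := by
    have hne : S.Nonempty := by rw [← Finset.card_pos]; omega
    obtain ⟨c₀, hc₀, hmax⟩ := S.exists_max_image D.head hne
    obtain ⟨c, hc, hmin⟩ := (S.filter fun l => D.head l = D.head c₀).exists_min_image id
      ⟨c₀, by simp [hc₀]⟩
    rw [Finset.mem_filter] at hc
    refine ⟨c, hc.1, fun l hl => ⟨by rw [hc.2]; exact hmax l hl, fun h => ?_⟩⟩
    exact hmin l (Finset.mem_filter.2 ⟨hl, h.trans hc.2⟩)
  set L := S.filter (· < c) with hL
  set R := S.filter (c < ·) with hR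
  have hcL : c ∉ L := by simp [hL]
  have hcR : c ∉ R := by simp [hR]
  have hSU : S = insert c (L ∪ R) := by
    ext l
    simp only [hL, hR, Finset.mem_insert, Finset.mem_union, Finset.mem_filter]
    constructor
    · intro hl
      rcases lt_trichotomy l c with h | h | h <;> simp [h, hl]
    · rintro (rfl | h | h)
      · exact hcS
      · exact h.1
      · exact h.1
  have hLR : Disjoint L R := by
    rw [Finset.disjoint_left]
    intro l hl hl'
    exact lt_asymm (Finset.mem_filter.1 hl).2 (Finset.mem_filter.1 hl').2
  have hLhead : ∀ l ∈ L, D.head l ≤ D.tail c := by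
    intro l hl
    obtain ⟨hlS, hlc⟩ := Finset.mem_filter.1 hl
    by_contra h
    have h1 := head_le_of_tail_lt hlc (not_le.1 h)
    have h2 := hcmax l hlS
    exact absurd (h2.2 (by omega)) (not_le.2 hlc)
  have hRdesc : ∀ l ∈ R, D.Descendant c l := by
    intro l hl
    obtain ⟨hlS, hlc⟩ := Finset.mem_filter.1 hl
    exact descendant_iff.2 ⟨hlc, (hcmax l hlS).1⟩
  have hRmem : ∀ l, l ∈ R ↔ D.Descendant c l := fun l =>
    ⟨hRdesc l, fun h => Finset.mem_filter.2 ⟨hcl c hcS l h, h.lt⟩⟩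
  have hLcl : ∀ l ∈ L, ∀ m, D.Descendant l m → m ∈ L := by
    intro l hl m hlm
    refine Finset.mem_filter.2 ⟨hcl l (Finset.mem_filter.1 hl).1 m hlm, ?_⟩
    rw [← D.tail_strictMono.lt_iff_lt]
    have := hlm.2
    have := hLhead l hl
    have := D.tail_add_two_le_head m
    omega
  have hRcl : ∀ l ∈ R, ∀ m, D.Descendant l m → m ∈ R := fun l hl m hlm =>
    (hRmem m).2 (((hRmem l).1 hl).trans hlm)
  have hcardS : N = L.card + R.card := by
    have : S.card = L.card + R.card + 1 := by
      conv_lhs => rw [hSU]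
      rw [Finset.card_insert_of_notMem (by simp [hcL, hcR]),
        Finset.card_union_of_disjoint hLR]
    omega
  have hbelow : D.below c = R.card := by
    unfold below
    congr 1
    ext l
    simp [hRmem]
  have hparent : ∀ l, D.IsParent c l ↔ l ∈ D.topsIn R := by
    intro l
    rw [topsIn, Finset.mem_filter, hRmem]
    constructor
    · rintro ⟨h1, h2⟩
      refine ⟨h1, fun m hm hml => ?_⟩
      have := h2 m hml
      have := ((hRmem m).1 hm).1
      omega
    · rintro ⟨h1, h2⟩
      refine ⟨h1, fun m hm => ?_⟩
      by_contra h
      exact h2 m ((hRmem m).2 (h1.of_lt_of_lt (D.tail_strictMono.lt_iff_lt.1 (not_le.1 h)) hm.lt))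
        hm
  have hbeyond : ∀ l, D.beyond l c = (R.filter (· < l)).card := by
    intro l
    unfold beyond
    congr 1
    ext m
    simp [hRmem, D.tail_strictMono.lt_iff_lt]
  have hctop : c ∈ D.topsIn S := by
    refine Finset.mem_filter.2 ⟨hcS, fun m hm hmc => ?_⟩
    have h1 := hLhead m (Finset.mem_filter.2 ⟨hm, hmc.lt⟩)
    have h2 := hmc.2
    have := D.tail_add_two_le_head c
    omega
  have htops : D.topsIn S = insert c (D.topsIn L) := by
    ext l
    rw [Finset.mem_insert]
    constructor
    · intro hl
      obtain ⟨h1, h2⟩ := Finset.mem_filter.1 hl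
      rcases lt_trichotomy l c with h | h | h
      · exact Or.inr (Finset.mem_filter.2 ⟨Finset.mem_filter.2 ⟨h1, h⟩,
          fun m hm => h2 m (Finset.mem_filter.1 hm).1⟩)
      · exact Or.inl h
      · exact absurd (hRdesc l (Finset.mem_filter.2 ⟨h1, h⟩)) (h2 c hcS)
    · rintro (rfl | hl)
      · exact hctop
      · obtain ⟨h1, h2⟩ := Finset.mem_filter.1 hl
        obtain ⟨h3, h4⟩ := Finset.mem_filter.1 h1
        exact Finset.mem_filter.2 ⟨h3, fun m hm hml =>
          h2 m (Finset.mem_filter.2 ⟨hm, hml.lt.trans h4⟩) hml⟩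
  have hctL : c ∉ D.topsIn L := fun h => hcL (Finset.mem_filter.1 h).1
  set gL : Fin k → ℝ := fun l => g l - if D.head l = D.tail c then f c else 0 with hgL
  set gR : Fin k → ℝ := fun l => g l - if D.head l = D.head c then g c else 0 with hgR
  have hLS : ∀ l ∈ L, l ∈ S := fun l hl => (Finset.mem_filter.1 hl).1
  have hRS : ∀ l ∈ R, l ∈ S := fun l hl => (Finset.mem_filter.1 hl).1
  have hU : L.card = 0 ∧ D.combSeq L f β gL δ ε a σ = 0 ∨
      ∃ l', L.card = l' + 1 ∧ VarBounded l' (D.combSeq L f β gL δ ε a σ) := by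
    rcases hc : L.card with _ | l'
    · left
      rw [Finset.card_eq_zero] at hc
      rw [hc]
      refine ⟨rfl, funext fun x => ?_⟩
      simp [combSeq, comb, topsIn]
    · right
      refine ⟨l', rfl, ih l' (by omega) L hc hLcl gL (fun l hl => ?_) (fun l hl m hm hd he => ?_)
        (fun l hl m hm he => ?_) σ (fun l hl => ?_)⟩
      · simp only [hgL]
        split_ifs with h
        · linarith [hfg c hcS l (hLS l hl) h]
        · linarith [hg l (hLS l hl)]
      · simp only [hgL]
        rw [he]
        linarith [hgg l (hLS l hl) m (hLS m hm) hd he]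
      · simp only [hgL]
        have := D.tail_strictMono (Finset.mem_filter.1 hl).2
        rw [if_neg (by omega)]
        linarith [hfg l (hLS l hl) m (hLS m hm) he]
      · have h1 := hσ l (by rw [htops]; exact Finset.mem_insert_of_mem hl)
        have h2 : S.filter (· < l) = L.filter (· < l) := by
          ext m
          simp only [hL, Finset.mem_filter]
          have := (Finset.mem_filter.1 (Finset.mem_filter.1 hl).1).2
          exact ⟨fun h => ⟨⟨h.1, h.2.trans this⟩, h.2⟩, fun h => ⟨h.1.1, h.2⟩⟩
        rwa [h2] at h1
  have hW : R.card = 0 ∧ D.combSeq R f β gR δ ε a 1 = 0 ∨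
      ∃ r', R.card = r' + 1 ∧ VarBounded r' (D.combSeq R f β gR δ ε a 1) := by
    rcases hc : R.card with _ | r'
    · left
      rw [Finset.card_eq_zero] at hc
      rw [hc]
      refine ⟨rfl, funext fun x => ?_⟩
      simp [combSeq, comb, topsIn]
    · right
      refine ⟨r', rfl, ih r' (by omega) R hc hRcl gR (fun l hl => ?_) (fun l hl m hm hd he => ?_)
        (fun l hl m hm he => ?_) 1 (fun l hl => ?_)⟩
      · simp only [hgR]
        split_ifs with h
        · linarith [hgg l (hRS l hl) c hcS (hRdesc l hl) h]
        · linarith [hg l (hRS l hl)]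
      · simp only [hgR]
        rw [he]
        linarith [hgg l (hRS l hl) m (hRS m hm) hd he]
      · simp only [hgR]
        have := (hRdesc l hl).2
        have := D.tail_add_two_le_head l
        rw [if_neg (by omega)]
        linarith [hfg l (hRS l hl) m (hRS m hm) he]
      · have := hε l c ((hparent l).2 hl)
        rwa [hbeyond, ← one_mul (ε l)] at this
  have key := varBounded_joinSeq (b := a c) (D.one_le_tail c) (D.tail_add_two_le_head c) (hf c)
    (hg c hcS) (hβ c) (hσ c hctop) (by have := hδ c; rwa [hbelow] at this) hU hW
  rw [hcardS]
  convert key using 1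
  ext x
  have hcT : D.tailCoeff ε a c = a c + D.combSeq R f β gR δ ε a 1 0 := by
    simp only [tailCoeff, combSeq, if_true, one_mul, hparent]
    rw [← Finset.sum_filter]
    congr 2
    ext l
    simp
  have hsplit : D.comb S f β g δ ε a x = (D.tailCoeff ε a c * β c *
      (f c * (if x = D.tail c then 1 else 0) + if x = D.tail c + 1 then 1 else 0) +
    a c * δ c * (g c * (if x = D.head c then 1 else 0) + if x = D.head c + 1 then 1 else 0)) +
      (D.comb L f β g δ ε a x + D.comb R f β g δ ε a x) := by
    unfold comb
    conv_lhs => rw [hSU]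
    rw [Finset.sum_insert (by simp [hcL, hcR]), Finset.sum_union hLR]
  have hLz : ∀ (g : Fin k → ℝ) (x : ℕ), D.tail c + 1 < x → D.comb L f β g δ ε a x = 0 :=
    fun g x hx => comb_eq_zero fun l hl => Or.inr (by have := hLhead l hl; omega)
  have hRz1 : ∀ (g : Fin k → ℝ) (x : ℕ), x ≤ D.tail c → D.comb R f β g δ ε a x = 0 :=
    fun g x hx => comb_eq_zero fun l hl => Or.inl (by have := (hRdesc l hl).1; omega)
  have hRz2 : ∀ (g : Fin k → ℝ) (x : ℕ), D.head c + 1 < x → D.comb R f β g δ ε a x = 0 :=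
    fun g x hx => comb_eq_zero fun l hl => Or.inr (by have := (hRdesc l hl).2; omega)
  have hLs : ∀ x, D.comb L f β g δ ε a x = D.comb L f β gL δ ε a x +
      if x = D.tail c then f c * D.comb L f β gL δ ε a (D.tail c + 1) else 0 :=
    comb_shift hLhead (f c)
  have hRs : ∀ x, D.comb R f β g δ ε a x = D.comb R f β gR δ ε a x +
      if x = D.head c then g c * D.comb R f β gR δ ε a (D.head c + 1) else 0 :=
    comb_shift (fun l hl => (hRdesc l hl).2) (g c)
  have h2 := D.tail_add_two_le_head c
  rw [← hcT]
  unfold joinSeq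
  by_cases hx : x = 0
  · subst hx
    simp only [combSeq, if_true]
    rw [htops, Finset.sum_insert hctL]
    ring
  simp only [combSeq, if_neg hx, Nat.add_one_ne_zero, if_false]
  rw [hsplit, hLs x, hRs x]
  rcases lt_trichotomy x (D.tail c) with h | rfl | h
  · simp only [hRz1 _ x h.le, h, h.ne, show x ≠ D.tail c + 1 by omega,
      show x ≠ D.head c by omega, show x ≠ D.head c + 1 by omega, if_true, if_false]
    ring
  · simp only [hRz1 _ _ le_rfl, lt_irrefl, show D.tail c ≠ D.tail c + 1 by omega,
      show D.tail c ≠ D.head c by omega, show D.tail c ≠ D.head c + 1 by omega, if_true, if_false]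
    simp only [hx, if_false]
    ring
  by_cases hx1 : x = D.tail c + 1
  · subst hx1
    simp only [show ¬ D.tail c + 1 < D.tail c by omega, show D.tail c + 1 ≠ D.tail c by omega,
      show D.tail c + 1 ≠ D.head c by omega, show D.tail c + 1 ≠ D.head c + 1 by omega,
      if_true, if_false]
    ring
  have hx2 := not_lt.2 h.le
  rcases lt_trichotomy x (D.head c) with h' | rfl | h'
  · simp only [hLz _ x (by omega), hx2, h.ne', hx1, h', h'.ne, show x ≠ D.head c + 1 by omega,
      if_true, if_false]
    ring
  · simp only [hLz _ (D.head c) (by omega), hx2, h.ne', hx1, lt_irrefl,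
      show D.head c ≠ D.head c + 1 by omega, if_true, if_false]
    simp only [hx, if_false]
    ring
  have hx3 := not_lt.2 h'.le
  by_cases hx4 : x = D.head c + 1
  · subst hx4
    simp only [hLz _ (D.head c + 1) (by omega), hx2, h.ne', hx1, hx3, h'.ne', if_true, if_false]
    ring
  · simp only [hLz _ x (by omega), hRz2 _ x (by omega), hx2, h.ne', hx1, hx3, h'.ne', hx4,
      if_false]
    ring

end ChordDiagram

namespace ChordDiagram

variable {n k : ℕ} {D : ChordDiagram n k} {α β γ δ ε : Fin k → ℝ}

theorem IsParent.unique {l p q : Fin k} (hp : D.IsParent p l) (hq : D.IsParent q l) : p = q :=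
  D.tail_strictMono.injective (le_antisymm (hq.2 p hp.1) (hp.2 q hq.1))

theorem exists_isParent {l : Fin k} (hl : ¬ D.IsTop l) : ∃ p, D.IsParent p l := by
  unfold IsTop at hl
  push Not at hl
  obtain ⟨m, hm⟩ := hl
  obtain ⟨p, hp, hmax⟩ := (Finset.univ.filter fun m => D.Descendant m l).exists_max_image D.tail
    ⟨m, by simp [hm]⟩
  exact ⟨p, (Finset.mem_filter.1 hp).2, fun m' hm' => hmax m' (by simp [hm'])⟩

theorem IsParent.not_isTop {l p : Fin k} (hp : D.IsParent p l) : ¬ D.IsTop l :=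
  fun h => h p hp.1

theorem SignRules.alpha_pos (hs : D.SignRules α β γ δ ε) (l : Fin k) : 0 < α l := hs.1 l

theorem SignRules.beta_pos (hs : D.SignRules α β γ δ ε) (l : Fin k) : 0 < β l := hs.2.1 l

theorem SignRules.delta_ne_zero (hs : D.SignRules α β γ δ ε) (l : Fin k) : δ l ≠ 0 :=
  right_ne_zero_of_mul (hs.2.2.2.1 l).ne'

theorem SignRules.eps_ne_zero (hs : D.SignRules α β γ δ ε) (l : Fin k) : ε l ≠ 0 := by
  by_cases hl : D.IsTop l
  · exact right_ne_zero_of_mul (hs.2.2.2.2.1 l hl).ne'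
  · obtain ⟨p, hp⟩ := exists_isParent hl
    exact right_ne_zero_of_mul (hs.2.2.2.2.2.1 l p hp).ne'

theorem SignRules.delta_div_gamma_pos (hs : D.SignRules α β γ δ ε) (l : Fin k) :
    0 < δ l / γ l := by
  have h := div_pos (hs.2.2.2.1 l) (hs.2.2.1 l)
  rwa [mul_div_mul_left _ _ (by simp)] at h

theorem SignRules.delta_div_gamma_lt (hs : D.SignRules α β γ δ ε) {m : Fin k} (l : Fin k)
    (hd : D.Descendant m l) (hh : D.head l = D.head m) : δ l / γ l < δ m / γ m := by
  induction l using WellFoundedLT.induction with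
  | _ l ih =>
  obtain ⟨p, hp⟩ := exists_isParent fun h => h m hd
  rcases (D.tail_strictMono.le_iff_le.1 (hp.2 m hd)).eq_or_lt with rfl | hmp
  · exact hs.2.2.2.2.2.2.1 l m hp hh
  · have hmp' := hd.of_lt_of_lt hmp hp.1.lt
    have hph : D.head p = D.head m := le_antisymm hmp'.2 (hh ▸ hp.1.2)
    exact (hs.2.2.2.2.2.2.1 l p hp (hh.trans hph.symm)).trans (ih p hp.1.lt hmp' hph)

variable (D) in
/-- The part of the combination with coefficients `a` of the rows of a domino matrix supported
on the markers of the chords. -/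
def chordSum (α β γ δ ε a : Fin k → ℝ) (y : ℕ) : ℝ :=
  ∑ d, (D.tailCoeff ε a d *
      (α d * (if y = D.tail d then 1 else 0) + β d * if y = D.tail d + 1 then 1 else 0) +
    a d * (γ d * (if y = D.head d then 1 else 0) + δ d * if y = D.head d + 1 then 1 else 0))

theorem mem_topsIn_univ {l : Fin k} : l ∈ D.topsIn Finset.univ ↔ D.IsTop l := by
  simp [topsIn, IsTop]

theorem vecMul_dominoMatrix (α β γ δ ε a : Fin k → ℝ) (x : Fin n) :
    Matrix.vecMul a (D.dominoMatrix α β γ δ ε) x = D.chordSum α β γ δ ε a (x + 1) +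
      if (x : ℕ) + 1 = n then ∑ l ∈ D.topsIn Finset.univ, ε l * a l else 0 := by
  have h1 : ∀ l, a l * D.dominoMatrix α β γ δ ε l x =
      a l * (α l * (if (x : ℕ) + 1 = D.tail l then 1 else 0) +
        β l * if (x : ℕ) + 1 = D.tail l + 1 then 1 else 0) +
      a l * (γ l * (if (x : ℕ) + 1 = D.head l then 1 else 0) +
        δ l * if (x : ℕ) + 1 = D.head l + 1 then 1 else 0) +
      (if (x : ℕ) + 1 = n then if D.IsTop l then ε l * a l else 0 else 0) +
      ∑ m, (if D.IsParent m l then ε l * a l else 0) *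
        (α m * (if (x : ℕ) + 1 = D.tail m then 1 else 0) +
          β m * if (x : ℕ) + 1 = D.tail m + 1 then 1 else 0) := by
    intro l
    have h2 : ∀ m, a l * (if D.IsParent m l then
        (if (x : ℕ) + 1 = D.tail m then ε l * α m else 0) +
        (if (x : ℕ) + 1 = D.tail m + 1 then ε l * β m else 0)
      else 0) = (if D.IsParent m l then ε l * a l else 0) *
        (α m * (if (x : ℕ) + 1 = D.tail m then 1 else 0) +
          β m * if (x : ℕ) + 1 = D.tail m + 1 then 1 else 0) := by
      intro m
      split_ifs <;> ring
    simp only [dominoMatrix, Matrix.of_apply]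
    rw [mul_add, Finset.mul_sum, Finset.sum_congr rfl fun m _ => h2 m]
    congr 1
    by_cases h3 : D.IsTop l <;> simp only [h3, true_and, false_and, if_true, if_false] <;>
      split_ifs <;> ring
  simp only [Matrix.vecMul, dotProduct]
  rw [Finset.sum_congr rfl fun l _ => h1 l]
  simp only [Finset.sum_add_distrib]
  rw [Finset.sum_comm (γ := Fin k)]
  simp only [chordSum, tailCoeff, add_mul, Finset.sum_add_distrib, Finset.sum_mul]
  have h4 : (∑ l, if (x : ℕ) + 1 = n then if D.IsTop l then ε l * a l else 0 else 0) =
      if (x : ℕ) + 1 = n then ∑ l ∈ D.topsIn Finset.univ, ε l * a l else 0 := by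
    split_ifs
    · rw [← Finset.sum_filter]
      exact Finset.sum_congr (by ext l; simp [mem_topsIn_univ]) fun _ _ => rfl
    · simp
  rw [h4]
  ring

theorem SignRules.chordSum_eq_comb (hs : D.SignRules α β γ δ ε) (a : Fin k → ℝ) (y : ℕ) :
    D.chordSum α β γ δ ε a y =
      D.comb Finset.univ (fun l => α l / β l) β (fun l => γ l / δ l) δ ε a y := by
  refine Finset.sum_congr rfl fun l _ => ?_
  have := (hs.beta_pos l).ne'
  have := hs.delta_ne_zero l
  field_simp

theorem chordSum_eq_zero (D : ChordDiagram n k) {a : Fin k → ℝ} {y : ℕ} (hy : n ≤ y) :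
    D.chordSum α β γ δ ε a y = 0 := by
  refine Finset.sum_eq_zero fun l _ => ?_
  have := D.tail_add_two_le_head l
  have := D.head_add_two_le l
  rw [if_neg (by omega), if_neg (by omega), if_neg (by omega), if_neg (by omega)]
  ring

theorem neg_one_pow_behind (D : ChordDiagram n k) (l : Fin k) :
    (-1 : ℝ) ^ D.behind l =
      (-1 : ℝ) ^ (Finset.univ.filter (· < l)).card * (-1) ^ (k - 1) := by
  have h1 : D.behind l = (Finset.Ioi l).card := by
    unfold behind
    congr 1
    ext m
    simp [D.tail_strictMono.lt_iff_lt]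
  have h2 : (Finset.univ.filter (· < l)).card = (Finset.Iio l).card := by
    congr 1
    ext m
    simp
  rw [h1, h2, Fin.card_Ioi, Fin.card_Iio, ← pow_add,
    show (l : ℕ) + (k - 1) = (k - 1 - l) + 2 * l by omega, pow_add, pow_mul]
  simp

/-- A linear combination of the rows of a domino matrix of `k` chords changes sign at most
`k - 1` times. -/
theorem SignRules.exists_sign_index (hs : D.SignRules α β γ δ ε) (hk : 1 ≤ k)
    (a : Fin k → ℝ) : ∃ (s : ℝ) (g : ℕ → ℕ), (s = 1 ∨ s = -1) ∧ Monotone g ∧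
      (∀ y, g y ≤ k - 1) ∧
      ∀ x : Fin n, 0 ≤ (-1 : ℝ) ^ g (x + 1) *
        (s * Matrix.vecMul a (D.dominoMatrix α β γ δ ε) x) := by
  have hvar := varBounded_combSeq (D := D) (f := fun l => α l / β l) (a := a)
    (fun l => (div_pos (hs.alpha_pos l) (hs.beta_pos l)).le) (fun l => (hs.beta_pos l).le)
    (fun l => (hs.2.2.2.1 l).le) (fun l m h => (hs.2.2.2.2.2.1 l m h).le) (k - 1)
    Finset.univ (by simp; omega) (fun _ _ _ _ => Finset.mem_univ _) (fun l => γ l / δ l)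
    (fun l _ => by
      rw [← inv_div]; exact (inv_pos.2 (hs.delta_div_gamma_pos l)).le)
    (fun l _ m _ hd hh => by
      rw [← inv_div, ← inv_div (δ l)]
      exact (inv_le_inv₀ (hs.delta_div_gamma_pos m) (hs.delta_div_gamma_pos l)).2
        (hs.delta_div_gamma_lt l hd hh).le)
    (fun l _ m _ hh => by
      rw [← inv_div, ← inv_div (δ m)]
      exact (inv_le_inv₀ (div_pos (hs.beta_pos l) (hs.alpha_pos l))
        (hs.delta_div_gamma_pos m)).2 (hs.2.2.2.2.2.2.2 l m hh).le)
    ((-1) ^ (k - 1)) (fun l hl => by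
      have := (hs.2.2.2.2.1 l (mem_topsIn_univ.1 hl)).le
      rwa [neg_one_pow_behind, mul_assoc] at this)
  obtain ⟨τ, hτ, g, hg, hb, hsg⟩ : ∃ τ : ℝ, (τ = 1 ∨ τ = -1) ∧ SignBounded (k - 1)
      (fun y => τ * D.combSeq Finset.univ (fun l => α l / β l) β (fun l => γ l / δ l) δ ε a
        ((-1) ^ (k - 1)) y) := by
    rcases hvar with h | h
    · exact ⟨1, Or.inl rfl, by simpa using h⟩
    · exact ⟨-1, Or.inr rfl, by simp only [neg_one_mul]; exact h⟩
  refine ⟨τ * (-1) ^ g 0, fun y => if y < n then g y - g 0 else k - 1, ?_, fun y z hyz => ?_,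
    fun y => ?_, fun x => ?_⟩
  · rcases hτ with rfl | rfl <;> rcases neg_one_pow_eq_or ℝ (g 0) with h | h <;> simp [h]
  · have := hg hyz
    have := hb y
    dsimp only
    split_ifs <;> omega
  · have := hb y
    dsimp only
    split_ifs <;> omega
  · rw [vecMul_dominoMatrix]
    dsimp only
    have hx := x.2
    by_cases h : (x : ℕ) + 1 = n
    · rw [if_neg (by omega), if_pos h, chordSum_eq_zero D h.ge, zero_add]
      have := hsg 0
      simp only [combSeq, if_true] at this
      convert this using 1
      ring
    · rw [if_pos (by omega), if_neg h, add_zero, hs.chordSum_eq_comb]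
      have h1 := hsg (x + 1)
      simp only [combSeq, Nat.add_one_ne_zero, if_false] at h1
      have h2 := hg (Nat.zero_le (x + 1))
      obtain ⟨t, ht⟩ := Nat.exists_eq_add_of_le h2
      rw [ht, pow_add] at h1
      rw [ht, Nat.add_sub_cancel_left]
      convert h1 using 1
      ring

end ChordDiagram

namespace ChordDiagram

variable {n k : ℕ} {D : ChordDiagram n k} {α β γ δ ε a : Fin k → ℝ}

theorem chordSum_tail {d : Fin k}
    (hT : ∀ e, D.tail e + 1 = D.tail d → D.tailCoeff ε a e = 0)
    (ha : ∀ l, D.head l = D.tail d ∨ D.head l + 1 = D.tail d → a l = 0) :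
    D.chordSum α β γ δ ε a (D.tail d) = D.tailCoeff ε a d * α d := by
  unfold chordSum
  rw [Finset.sum_eq_single d]
  · have := D.tail_add_two_le_head d
    rw [if_pos rfl, if_neg (by omega), if_neg (by omega), if_neg (by omega)]
    ring
  · intro e _ hed
    rw [if_neg fun h => hed (D.tail_strictMono.injective h.symm)]
    have h1 : D.tailCoeff ε a e * (α e * 0 +
        β e * if D.tail d = D.tail e + 1 then 1 else 0) = 0 := by
      split_ifs with h
      · rw [hT e h.symm, zero_mul]
      · ring
    have h2 : a e * (γ e * (if D.tail d = D.head e then 1 else 0) +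
        δ e * if D.tail d = D.head e + 1 then 1 else 0) = 0 := by
      by_cases h : D.head e = D.tail d ∨ D.head e + 1 = D.tail d
      · rw [ha e h, zero_mul]
      · rw [if_neg fun h' => h (Or.inl h'.symm), if_neg fun h' => h (Or.inr h'.symm)]
        ring
    rw [h1, h2, add_zero]
  · simp

theorem chordSum_tail_add_one {d : Fin k}
    (hT : ∀ e, D.tail e = D.tail d + 1 → D.tailCoeff ε a e = 0)
    (ha : ∀ l, D.head l = D.tail d + 1 ∨ D.head l = D.tail d → a l = 0) :
    D.chordSum α β γ δ ε a (D.tail d + 1) = D.tailCoeff ε a d * β d := by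
  unfold chordSum
  rw [Finset.sum_eq_single d]
  · have := D.tail_add_two_le_head d
    rw [if_pos rfl, if_neg (by omega), if_neg (by omega), if_neg (by omega)]
    ring
  · intro e _ hed
    have h0 : ¬ D.tail d + 1 = D.tail e + 1 :=
      fun h => hed (D.tail_strictMono.injective (by omega))
    rw [if_neg h0]
    have h1 : D.tailCoeff ε a e * (α e * (if D.tail d + 1 = D.tail e then 1 else 0) +
        β e * 0) = 0 := by
      split_ifs with h
      · rw [hT e h.symm, zero_mul]
      · ring
    have h2 : a e * (γ e * (if D.tail d + 1 = D.head e then 1 else 0) +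
        δ e * if D.tail d + 1 = D.head e + 1 then 1 else 0) = 0 := by
      by_cases h : D.head e = D.tail d + 1 ∨ D.head e = D.tail d
      · rw [ha e h, zero_mul]
      · rw [if_neg (by omega), if_neg (by omega)]
        ring
    rw [h1, h2, add_zero]
  · simp

theorem eq_zero_of_tailCoeff_eq_zero {X : ℕ}
    (hT : ∀ e, D.tail e < X → D.tailCoeff ε a e = 0) (l : Fin k) (hl : D.head l ≤ X) :
    a l = 0 := by
  induction l using WellFoundedGT.induction with
  | _ l ih =>
  have h1 := D.tail_add_two_le_head l
  have h2 := hT l (by omega)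
  rw [tailCoeff, Finset.sum_eq_zero, add_zero] at h2
  · exact h2
  · intro h _
    split_ifs with hp
    · rw [ih h hp.1.lt (hp.1.2.trans hl), mul_zero]
    · rfl

/-- If a linear combination of the rows of a domino matrix vanishes away from the markers of the
chord `c_m`, then its entries at the tail of `c_m` are proportional to `(α_m, β_m)`. -/
theorem chordSum_tail_of_vanishing {m : Fin k} (hα : ∀ l, α l ≠ 0) (hβ : ∀ l, β l ≠ 0)
    (hv : ∀ y, 1 ≤ y → y < n → y ≠ D.tail m → y ≠ D.tail m + 1 → y ≠ D.head m →
      y ≠ D.head m + 1 → D.chordSum α β γ δ ε a y = 0) :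
    D.chordSum α β γ δ ε a (D.tail m) = D.tailCoeff ε a m * α m ∧
      D.chordSum α β γ δ ε a (D.tail m + 1) = D.tailCoeff ε a m * β m := by
  have hm := D.tail_add_two_le_head m
  have hmn := D.head_add_two_le m
  have before : ∀ d, d < m → D.tailCoeff ε a d = 0 := by
    intro d
    induction d using WellFoundedLT.induction with
    | _ d ih =>
    intro hdm
    have hdm' := D.tail_strictMono hdm
    have hlt : ∀ e, D.tail e < D.tail d → D.tailCoeff ε a e = 0 := fun e he => by
      have := D.tail_strictMono.lt_iff_lt.1 he
      exact ih e this (this.trans hdm)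
    have h1 := chordSum_tail (D := D) (α := α) (β := β) (γ := γ) (δ := δ) (ε := ε) (a := a)
      (d := d) (fun e he => hlt e (by omega))
      (fun l hl => eq_zero_of_tailCoeff_eq_zero hlt l (by omega))
    rw [hv _ (D.one_le_tail d) (by omega) (by omega) (by omega) (by omega) (by omega)] at h1
    exact (mul_eq_zero.1 h1.symm).resolve_right (hα d)
  have chain : ∀ d, D.tail m < D.tail d → D.tail d < D.head m →
      (∀ x, D.tail m < x → x ≤ D.tail d → ∃ e, D.tail e = x) → D.tailCoeff ε a d = 0 := by
    intro d
    induction d using WellFoundedGT.induction with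
    | _ d ih =>
    intro h1 h2 h3
    have h4 := head_le_of_tail_lt (D.tail_strictMono.lt_iff_lt.1 h1) h2
    have h5 := D.tail_add_two_le_head d
    have h6 := chordSum_tail_add_one (D := D) (α := α) (β := β) (γ := γ) (δ := δ) (ε := ε)
      (a := a) (d := d) (fun e he => ih e (D.tail_strictMono.lt_iff_lt.1 (by omega)) (by omega)
        (by omega) fun x hx hx' => by
          rcases hx'.lt_or_eq with h | h
          · exact h3 x hx (by omega)
          · exact ⟨e, h.symm⟩) (fun l hl => by
        exfalso
        have hll := D.tail_add_two_le_head l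
        rcases hl with hl | hl
        · have := head_le_of_tail_lt (D := D) (l := l) (m := d)
            (D.tail_strictMono.lt_iff_lt.1 (by omega)) (by omega)
          omega
        · obtain ⟨e, he⟩ : ∃ e, D.tail e = D.tail d - 1 := by
            by_cases h : D.tail d - 1 = D.tail m
            · exact ⟨m, h.symm⟩
            · exact h3 _ (by omega) (by omega)
          have hee := D.tail_add_two_le_head e
          have := head_le_of_tail_lt (D := D) (l := l) (m := e)
            (D.tail_strictMono.lt_iff_lt.1 (by omega)) (by omega)
          omega)
    rw [hv _ (by omega) (by omega) (by omega) (by omega) (by omega) (by omega)] at h6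
    exact (mul_eq_zero.1 h6.symm).resolve_right (hβ d)
  have hlt : ∀ e, D.tail e < D.tail m → D.tailCoeff ε a e = 0 :=
    fun e he => before e (D.tail_strictMono.lt_iff_lt.1 he)
  refine ⟨chordSum_tail (fun e he => hlt e (by omega))
    (fun l hl => eq_zero_of_tailCoeff_eq_zero hlt l (by omega)),
    chordSum_tail_add_one (fun e he => chain e (by omega) (by omega) fun x hx hx' =>
      ⟨e, by omega⟩) (fun l hl => ?_)⟩
  rcases hl with hl | hl
  · exfalso
    have hll := D.tail_add_two_le_head l
    have := head_le_of_tail_lt (D := D) (l := l) (m := m)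
      (D.tail_strictMono.lt_iff_lt.1 (by omega)) (by omega)
    omega
  · exact eq_zero_of_tailCoeff_eq_zero hlt l hl.le

theorem dominoMatrix_row_eq {α' β' γ' δ' ε' : Fin k → ℝ} {l : Fin k} {c : ℝ}
    (htop : D.IsTop l → ε' l = c * ε l)
    (hpar : ∀ p, D.IsParent p l → ε' l * α' p = c * (ε l * α p) ∧
      ε' l * β' p = c * (ε l * β p)) (x : Fin n) :
    D.dominoMatrix α' β' γ' δ' ε' l x = c * D.dominoMatrix α β γ δ ε l x +
      ((α' l - c * α l) * (if (x : ℕ) + 1 = D.tail l then 1 else 0) +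
      (β' l - c * β l) * (if (x : ℕ) + 1 = D.tail l + 1 then 1 else 0) +
      (γ' l - c * γ l) * (if (x : ℕ) + 1 = D.head l then 1 else 0) +
      (δ' l - c * δ l) * (if (x : ℕ) + 1 = D.head l + 1 then 1 else 0)) := by
  have h1 : (∑ m : Fin k, if D.IsParent m l then
        (if (x : ℕ) + 1 = D.tail m then ε' l * α' m else 0) +
        (if (x : ℕ) + 1 = D.tail m + 1 then ε' l * β' m else 0)
      else 0) = c * ∑ m : Fin k, if D.IsParent m l then
        (if (x : ℕ) + 1 = D.tail m then ε l * α m else 0) +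
        (if (x : ℕ) + 1 = D.tail m + 1 then ε l * β m else 0)
      else 0 := by
    rw [Finset.mul_sum]
    refine Finset.sum_congr rfl fun m _ => ?_
    split_ifs with hm
    · rw [(hpar m hm).1, (hpar m hm).2]; ring
    · rw [(hpar m hm).1]; ring
    · rw [(hpar m hm).2]; ring
    all_goals ring
  have h2 : (if D.IsTop l ∧ (x : ℕ) + 1 = n then ε' l else 0) =
      c * if D.IsTop l ∧ (x : ℕ) + 1 = n then ε l else 0 := by
    split_ifs with h
    · exact htop h.1
    · ring
  simp only [dominoMatrix, Matrix.of_apply]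
  rw [h1, h2]
  split_ifs <;> ring

end ChordDiagram

theorem mem_rowSpace_iff {k n : ℕ} {A : Matrix (Fin k) (Fin n) ℝ} {v : Fin n → ℝ} :
    v ∈ rowSpace A ↔ ∃ a, Matrix.vecMul a A = v := by
  rw [rowSpace, Submodule.mem_span_range_iff_exists_fun]
  simp only [Matrix.vecMul_eq_sum]

namespace ChordDiagram

variable {n k : ℕ} {D : ChordDiagram n k} {α β γ δ ε : Fin k → ℝ}

theorem SignRules.eq_vecMul_of_eq_off (hs : D.SignRules α β γ δ ε) (hk : 1 ≤ k)
    (hn : k + 4 ≤ n) {Z : Matrix (Fin n) (Fin (k + 4)) ℝ} (hZ : IsPositiveMatrix Z)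
    {u : Fin n → ℝ} {a b : Fin k → ℝ} (l : Fin k)
    (hu : Matrix.vecMul (u - Matrix.vecMul a (D.dominoMatrix α β γ δ ε)) Z = 0)
    (hoff : ∀ x : Fin n, (x : ℕ) + 1 ≠ D.tail l → (x : ℕ) + 1 ≠ D.tail l + 1 →
      (x : ℕ) + 1 ≠ D.head l → (x : ℕ) + 1 ≠ D.head l + 1 →
      u x = Matrix.vecMul b (D.dominoMatrix α β γ δ ε) x) :
    u = Matrix.vecMul a (D.dominoMatrix α β γ δ ε) := by
  set C := D.dominoMatrix α β γ δ ε
  obtain ⟨s, g, hs1, hg, hb, hsg⟩ := hs.exists_sign_index hk (b - a)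
  rw [← sub_eq_zero]
  set w := u - Matrix.vecMul a C with hw
  have choice : ∀ (N : ℕ) (r : ℝ), ∃ p ≤ 1, 0 ≤ (-1 : ℝ) ^ (N + p) * r := by
    intro N r
    rcases le_total 0 ((-1 : ℝ) ^ N * r) with h | h
    · exact ⟨0, by omega, by simpa using h⟩
    · exact ⟨1, le_rfl, by rw [pow_succ]; linarith⟩
  have h1 := D.one_le_tail l
  have h2 := D.tail_add_two_le_head l
  have h3 := D.head_add_two_le l
  obtain ⟨p0, hp0, hq0⟩ := choice (g (D.tail l)) (s * w ⟨D.tail l - 1, by omega⟩)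
  obtain ⟨p1, hp1, hq1⟩ := choice (g (D.tail l + 1) + 1) (s * w ⟨D.tail l, by omega⟩)
  obtain ⟨p2, hp2, hq2⟩ := choice (g (D.head l) + 2) (s * w ⟨D.head l - 1, by omega⟩)
  obtain ⟨p3, hp3, hq3⟩ := choice (g (D.head l + 1) + 3) (s * w ⟨D.head l, by omega⟩)
  set st : ℕ → ℕ → ℕ → ℕ := fun i p y => if y < i then 0 else if y = i then p else 1 with hst
  have hstm : ∀ {i p : ℕ}, p ≤ 1 → ∀ {y z : ℕ}, y ≤ z → st i p y ≤ st i p z := by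
    intro i p hp y z hyz
    simp only [hst]
    split_ifs <;> omega
  have hst1 : ∀ {i p : ℕ}, p ≤ 1 → ∀ y : ℕ, st i p y ≤ 1 := by
    intro i p hp y
    simp only [hst]
    split_ifs <;> omega
  have st_lt : ∀ {i p y : ℕ}, y < i → st i p y = 0 := fun h => if_pos h
  have st_eq : ∀ {i p y : ℕ}, y = i → st i p y = p := fun h => by simp [hst, h]
  have st_gt : ∀ {i p y : ℕ}, i < y → st i p y = 1 := fun h => by
    simp only [hst]
    rw [if_neg (by omega), if_neg (by omega)]
  set q : ℕ → ℕ := fun y => st (D.tail l) p0 y + st (D.tail l + 1) p1 y + st (D.head l) p2 y +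
    st (D.head l + 1) p3 y with hq
  have hqm : Monotone q := fun y z hyz => add_le_add (add_le_add (add_le_add (hstm hp0 hyz)
    (hstm hp1 hyz)) (hstm hp2 hyz)) (hstm hp3 hyz)
  have hq4 : ∀ y, q y ≤ 4 := fun y => add_le_add (add_le_add (add_le_add (hst1 hp0 y)
    (hst1 hp1 y)) (hst1 hp2 y)) (hst1 hp3 y)
  have hsw : s • w = 0 := by
    refine IsPositiveMatrix.eq_zero_of_vecMul_eq_zero (r := k + 3) hn hZ
      (g := fun x => g (x + 1) + q (x + 1)) ?_ (fun y z hyz => ?_) (fun y => ?_) (fun x => ?_)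
    · rw [Matrix.smul_vecMul, hu, smul_zero]
    · exact add_le_add (hg (by omega)) (hqm (by omega))
    · have := hb (y + 1)
      have := hq4 (y + 1)
      omega
    · rw [Pi.smul_apply, smul_eq_mul]
      by_cases e0 : (x : ℕ) + 1 = D.tail l
      · have : x = ⟨D.tail l - 1, by omega⟩ := Fin.ext (by simp only; omega)
        have hqx : q (x + 1) = p0 := by
          simp only [hq]
          rw [st_eq e0, st_lt (by omega), st_lt (by omega), st_lt (by omega)]
          rfl
        rw [hqx, e0, this]
        exact hq0
      by_cases e1 : (x : ℕ) + 1 = D.tail l + 1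
      · have : x = ⟨D.tail l, by omega⟩ := Fin.ext (by simp only; omega)
        have hqx : q (x + 1) = 1 + p1 := by
          simp only [hq]
          rw [st_gt (by omega), st_eq e1, st_lt (by omega), st_lt (by omega)]
          rfl
        rw [hqx, e1, this, ← add_assoc]
        exact hq1
      by_cases e2 : (x : ℕ) + 1 = D.head l
      · have : x = ⟨D.head l - 1, by omega⟩ := Fin.ext (by simp only; omega)
        have hqx : q (x + 1) = 2 + p2 := by
          simp only [hq]
          rw [st_gt (by omega), st_gt (by omega), st_eq e2, st_lt (by omega)]
          rfl
        rw [hqx, e2, this, ← add_assoc]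
        exact hq2
      by_cases e3 : (x : ℕ) + 1 = D.head l + 1
      · have : x = ⟨D.head l, by omega⟩ := Fin.ext (by simp only; omega)
        have hqx : q (x + 1) = 3 + p3 := by
          simp only [hq]
          rw [st_gt (by omega), st_gt (by omega), st_gt (by omega), st_eq e3]
        rw [hqx, e3, this, ← add_assoc]
        exact hq3
      have hqe : Even (q (x + 1)) := by
        simp only [hq]
        rcases lt_or_gt_of_ne e0 with h | h
        · rw [st_lt h, st_lt (by omega), st_lt (by omega), st_lt (by omega)]
          decide
        rcases lt_or_gt_of_ne e2 with h' | h'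
        · rw [st_gt h, st_gt (by omega), st_lt (by omega), st_lt (by omega)]
          decide
        · rw [st_gt h, st_gt (by omega), st_gt (by omega), st_gt (by omega)]
          decide
      have hwx : w x = Matrix.vecMul (b - a) C x := by
        rw [hw, Pi.sub_apply, hoff x e0 e1 e2 e3, Matrix.sub_vecMul, Pi.sub_apply]
      rw [pow_add, hqe.neg_one_pow, mul_one, hwx]
      exact hsg x
  have hs0 : s ≠ 0 := by rcases hs1 with rfl | rfl <;> norm_num
  exact (smul_eq_zero.1 hsw).resolve_left hs0

theorem SignRules.rowSpace_le (hs : D.SignRules α β γ δ ε) {α' β' γ' δ' ε' : Fin k → ℝ}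
    (hk : 1 ≤ k) (hn : k + 4 ≤ n) {Z : Matrix (Fin n) (Fin (k + 4)) ℝ}
    (hZ : IsPositiveMatrix Z)
    (himg : rowSpace (D.dominoMatrix α' β' γ' δ' ε' * Z) ≤
      rowSpace (D.dominoMatrix α β γ δ ε * Z)) :
    rowSpace (D.dominoMatrix α' β' γ' δ' ε') ≤ rowSpace (D.dominoMatrix α β γ δ ε) := by
  set C := D.dominoMatrix α β γ δ ε with hC
  set C' := D.dominoMatrix α' β' γ' δ' ε' with hC'
  have key : ∀ l, C' l ∈ rowSpace C ∧ α' l * β l = β' l * α l := by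
    intro l
    induction l using WellFoundedLT.induction with
    | _ l ih =>
    have hε := hs.eps_ne_zero l
    obtain ⟨c, htop, hpar⟩ : ∃ c, (D.IsTop l → ε' l = c * ε l) ∧
        ∀ p, D.IsParent p l → ε' l * α' p = c * (ε l * α p) ∧
          ε' l * β' p = c * (ε l * β p) := by
      by_cases hl : D.IsTop l
      · exact ⟨ε' l / ε l, fun _ => by field_simp, fun p hp => absurd hl hp.not_isTop⟩
      · obtain ⟨p, hp⟩ := exists_isParent hl
        have hα := (hs.alpha_pos p).ne'
        refine ⟨ε' l * α' p / (ε l * α p), fun h => absurd h hl, fun p' hp' => ?_⟩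
        obtain rfl := hp.unique hp'
        have := (ih p hp.1.lt).2
        constructor
        · field_simp
        · field_simp
          linear_combination -ε' l * this
    have hrow := dominoMatrix_row_eq (γ := γ) (δ := δ) (γ' := γ') (δ' := δ') htop hpar
    rw [← hC, ← hC'] at hrow
    have hsingle : ∀ x, Matrix.vecMul (Pi.single l c) C x = c * C l x := fun x => by simp
    obtain ⟨a, ha⟩ : ∃ a, Matrix.vecMul a (C * Z) = (C' * Z) l :=
      mem_rowSpace_iff.1 (himg (Submodule.subset_span ⟨l, rfl⟩))
    have hCl : C' l = Matrix.vecMul a C := by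
      refine hs.eq_vecMul_of_eq_off (b := Pi.single l c) hk hn hZ l ?_ fun x h1 h2 h3 h4 => ?_
      · rw [← hC, Matrix.sub_vecMul, Matrix.vecMul_vecMul, ha, sub_eq_zero]
        rfl
      · rw [← hC, hsingle, hrow, if_neg h1, if_neg h2, if_neg h3, if_neg h4]
        ring
    refine ⟨mem_rowSpace_iff.2 ⟨a, hCl.symm⟩, ?_⟩
    have hsum : ∀ y (_ : 1 ≤ y) (_ : y < n), D.chordSum α β γ δ ε (a - Pi.single l c) y =
        (α' l - c * α l) * (if y = D.tail l then 1 else 0) +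
        (β' l - c * β l) * (if y = D.tail l + 1 then 1 else 0) +
        (γ' l - c * γ l) * (if y = D.head l then 1 else 0) +
        (δ' l - c * δ l) * (if y = D.head l + 1 then 1 else 0) := by
      intro y h1 h2
      have h3 := vecMul_dominoMatrix (D := D) α β γ δ ε (a - Pi.single l c) ⟨y - 1, by omega⟩
      have h4 := hrow ⟨y - 1, by omega⟩
      simp only [Nat.sub_add_cancel h1] at h3 h4
      rw [if_neg (by omega), add_zero, ← hC, Matrix.sub_vecMul, Pi.sub_apply, hsingle, ← hCl,
        h4] at h3
      rw [← h3]
      ring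
    have hl1 := D.one_le_tail l
    have hl2 := D.tail_add_two_le_head l
    have hl3 := D.head_add_two_le l
    obtain ⟨e1, e2⟩ := chordSum_tail_of_vanishing (m := l) (fun m => (hs.alpha_pos m).ne')
      (fun m => (hs.beta_pos m).ne') fun y h1 h2 h3 h4 h5 h6 => by
        rw [hsum y h1 h2, if_neg h3, if_neg h4, if_neg h5, if_neg h6]
        ring
    rw [hsum _ hl1 (by omega), if_pos rfl, if_neg (by omega), if_neg (by omega),
      if_neg (by omega)] at e1
    rw [hsum _ (by omega) (by omega), if_pos rfl, if_neg (by omega), if_neg (by omega),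
      if_neg (by omega)] at e2
    linear_combination β l * e1 - α l * e2
  refine Submodule.span_le.2 ?_
  rintro _ ⟨l, rfl⟩
  exact (key l).1

end ChordDiagram

/-- **Injectivity.** Let `C, C'` be two domino matrices of the same chord
diagram `D`, both satisfying the sign rules, and let `Z` be positive.  If `C * Z` and
`C' * Z` have the same row space in `ℝ^(k+4)`, then `C` and `C'` have the same row space
in `ℝ^n`; i.e. the amplituhedron map is injective on the BCFW cell of `D`. -/
theorem amplituhedron_map_injective_on_bcfw_cell
    (n k : ℕ) (hk : 1 ≤ k) (hn : k + 4 ≤ n)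
    (D : ChordDiagram n k)
    (α β γ δ ε α' β' γ' δ' ε' : Fin k → ℝ)
    (hs : D.SignRules α β γ δ ε) (hs' : D.SignRules α' β' γ' δ' ε')
    (Z : Matrix (Fin n) (Fin (k + 4)) ℝ) (hZ : IsPositiveMatrix Z)
    (himg : rowSpace (D.dominoMatrix α β γ δ ε * Z) =
      rowSpace (D.dominoMatrix α' β' γ' δ' ε' * Z)) :
    rowSpace (D.dominoMatrix α β γ δ ε) = rowSpace (D.dominoMatrix α' β' γ' δ' ε') := by
  exact le_antisymm (hs'.rowSpace_le hk hn hZ himg.le) (hs.rowSpace_le hk hn hZ himg.ge)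

end
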